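/- Let N be a positive integer, let A be an N×N complex matrix, let Ω be an invertible N×N complex matrix, and suppose Ω A Ω⁻¹ = diag(a₁,…,a_N) is a diagonal matrix with real, pairwise distinct diagonal entries. If Θ is any positive-definite Hermitian N×N matrix satisfying Aᴴ Θ = Θ A, then there exists a function d : Fin N → ℝ with d(n) > 0 for all n such that Θ = Ωᴴ · diag(d(1),…,d(N)) · Ω. -/

import Mathlib

open scoped ComplexOrder
open Matrix

/-- A matrix commuting with a diagonal matrix with distinct entries is diagonal. -/
theorem Matrix.eq_diagonal_of_commute_diagonal {n R : Type*} [Fintype n] [DecidableEq n]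
    [CommRing R] [IsDomain R] {a : n → R} (ha : Function.Injective a) {M : Matrix n n R}
    (hM : Commute (diagonal a) M) : M = diagonal fun i => M i i := by
  ext i j
  rcases eq_or_ne i j with rfl | hij
  · simp
  · rw [diagonal_apply_ne _ hij]
    have key := congrFun₂ hM.eq i j
    rw [diagonal_mul, mul_diagonal, mul_comm (M i j)] at key
    by_contra hne
    exact hij (ha (mul_right_cancel₀ hne key))

/-- If `Ω A Ω⁻¹` is diagonal with real, pairwise distinct entries, then every
positive-definite Hermitian metric `Θ` with `Aᴴ Θ = Θ A` is of the form
`Θ = Ωᴴ diag(d) Ω` with positive `d`. -/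
theorem metric_of_simple_spectrum_is_rescaling (N : ℕ) (hN : 0 < N)
    (A Ω : Matrix (Fin N) (Fin N) ℂ) (hΩ : IsUnit Ω) (a : Fin N → ℝ)
    (ha : Function.Injective a)
    (hdiag : Ω * A * Ω⁻¹ = Matrix.diagonal fun n => (a n : ℂ))
    (Θ : Matrix (Fin N) (Fin N) ℂ)
    (hΘherm : Θ.IsHermitian) (hΘpos : Θ.PosDef)
    (h : Aᴴ * Θ = Θ * A) :
    ∃ d : Fin N → ℝ, (∀ n, 0 < d n) ∧
      Θ = Ωᴴ * Matrix.diagonal (fun n => (d n : ℂ)) * Ω := by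
  have hl : Ω⁻¹ * Ω = 1 := nonsing_inv_mul Ω ((isUnit_iff_isUnit_det Ω).mp hΩ)
  have hlH : Ωᴴ * (Ω⁻¹)ᴴ = 1 := by rw [← conjTranspose_mul, hl, conjTranspose_one]
  have hWunit : IsUnit Ω⁻¹ := isUnit_nonsing_inv_iff.mpr hΩ
  set D : Matrix (Fin N) (Fin N) ℂ := diagonal fun n => (a n : ℂ) with hD
  set M := (Ω⁻¹)ᴴ * Θ * Ω⁻¹ with hM
  have hDH : D = (Ω⁻¹)ᴴ * Aᴴ * Ωᴴ := by
    have hself : Dᴴ = D := by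
      rw [hD, diagonal_conjTranspose]
      congr 1
      ext n
      simp
    rw [← hself, ← hdiag]
    simp only [conjTranspose_mul, Matrix.mul_assoc]
  have hcomm : Commute D M := calc
    D * M = (Ω⁻¹)ᴴ * Aᴴ * (Ωᴴ * (Ω⁻¹)ᴴ) * Θ * Ω⁻¹ := by
      rw [hDH, hM]
      simp only [Matrix.mul_assoc]
    _ = (Ω⁻¹)ᴴ * (Aᴴ * Θ) * Ω⁻¹ := by
      rw [hlH]
      simp only [Matrix.mul_assoc, Matrix.one_mul]
    _ = (Ω⁻¹)ᴴ * Θ * (Ω⁻¹ * Ω) * A * Ω⁻¹ := by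
      rw [h, hl]
      simp only [Matrix.mul_assoc, Matrix.one_mul]
    _ = M * D := by
      rw [← hdiag, hM]
      simp only [Matrix.mul_assoc]
  have hMpos : M.PosDef :=
    hΘpos.conjTranspose_mul_mul_same (mulVec_injective_of_isUnit hWunit)
  have hMdiag := eq_diagonal_of_commute_diagonal (Complex.ofReal_injective.comp ha) hcomm
  refine ⟨fun n => (M n n).re, fun n => (Complex.pos_iff.mp hMpos.diag_pos).1, ?_⟩
  have hre : (fun n => ((M n n).re : ℂ)) = fun n => M n n :=
    funext fun n => Complex.ext rfl (Complex.pos_iff.mp hMpos.diag_pos).2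
  rw [hre, ← hMdiag, hM]
  calc
    Θ = (Ωᴴ * (Ω⁻¹)ᴴ) * Θ * (Ω⁻¹ * Ω) := by rw [hl, hlH, Matrix.one_mul, Matrix.mul_one]
    _ = Ωᴴ * ((Ω⁻¹)ᴴ * Θ * Ω⁻¹) * Ω := by simp only [Matrix.mul_assoc]
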